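/- There is no pair of nonnegative tolls (τ₁, τ₂) that simultaneously induces the optimal flow in both games: for all τ₁, τ₂ ≥ 0, it is not the case that both (the Wardrop equilibrium of Γ¹ under (τ₁, τ₂) equals 0, the minimizer of the total latency of Γ¹) and (the Wardrop equilibrium of Γ² under (τ₁, τ₂) equals 1/2, the minimizer of the total latency of Γ²). Concretely, if x ∈ [0,1] is a Wardrop equilibrium of Γ² under tolls (τ₁, τ₂) with x = 1/2, then x = 1/2 is also a Wardrop equilibrium of Γ¹ under the same tolls, and its total latency in Γ¹ is 1/4 > 0, the optimal value for Γ¹. -/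

import Mathlib

/-- In a two-link routing game with unit demand, a flow `x ∈ [0,1]` (amount on edge 1,
with `1 - x` on edge 2) is a Wardrop equilibrium under tolls `(τ₁, τ₂)` for latency
functions `(l₁, l₂)`. -/
def IsWardropEq (l₁ l₂ : ℝ → ℝ) (τ₁ τ₂ x : ℝ) : Prop :=
  x ∈ Set.Icc (0 : ℝ) 1 ∧
    (0 < x → l₁ x + τ₁ ≤ l₂ (1 - x) + τ₂) ∧
    (x < 1 → l₂ (1 - x) + τ₂ ≤ l₁ x + τ₁)

/-- The total latency of flow `x` under latencies `(l₁, l₂)`. -/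
def totalLatency (l₁ l₂ : ℝ → ℝ) (x : ℝ) : ℝ :=
  x * l₁ x + (1 - x) * l₂ (1 - x)

/-- No pair of nonnegative tolls simultaneously induces the optimal flow `0` in `Γ¹`
(latencies `l₁(x) = x`, `l₂(x) = 0`) and the optimal flow `1/2` in `Γ²` (latencies
`l₁(x) = 1`, `l₂(x) = x`). Concretely, whenever `x = 1/2` is a Wardrop equilibrium of `Γ²`
under tolls `(τ₁, τ₂)`, the flow `1/2` is also a Wardrop equilibrium of `Γ¹` under the same
tolls, and its total latency in `Γ¹` is `1/4 > 0`, the optimal value of `Γ¹`. -/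
theorem no_tolls_optimal_for_both (τ₁ τ₂ : ℝ) (hτ₁ : 0 ≤ τ₁) (hτ₂ : 0 ≤ τ₂) :
    ¬ (IsWardropEq (fun y => y) (fun _ => 0) τ₁ τ₂ 0 ∧
        IsWardropEq (fun _ => 1) (fun y => y) τ₁ τ₂ (1 / 2)) ∧
      ∀ x ∈ Set.Icc (0 : ℝ) 1, IsWardropEq (fun _ => 1) (fun y => y) τ₁ τ₂ x → x = 1 / 2 →
        IsWardropEq (fun y => y) (fun _ => 0) τ₁ τ₂ (1 / 2) ∧
          totalLatency (fun y => y) (fun _ => 0) (1 / 2) = 1 / 4 ∧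
          (0 : ℝ) < 1 / 4 ∧
          (∀ y ∈ Set.Icc (0 : ℝ) 1, totalLatency (fun y => y) (fun _ => 0) 0 ≤
            totalLatency (fun z => z) (fun _ => 0) y) ∧
          totalLatency (fun y => y) (fun _ => 0) 0 = 0 := by
  constructor
  · rintro ⟨⟨-, -, h₁⟩, -, h₂, h₃⟩
    have h₁ := h₁ (by norm_num)
    have h₃ := h₃ (by norm_num)
    have h₂ := h₂ (by norm_num)
    norm_num at h₁ h₂ h₃
    linarith
  · rintro x - ⟨-, h₁, h₂⟩ rfl
    have h₁ := h₁ (by norm_num)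
    have h₂ := h₂ (by norm_num)
    norm_num at h₁ h₂
    refine ⟨⟨by norm_num, fun _ => ?_, fun _ => ?_⟩, ?_, by norm_num, fun y _ => ?_, ?_⟩
    · linarith
    · linarith
    · norm_num [totalLatency]
    · simpa [totalLatency] using mul_self_nonneg y
    · simp [totalLatency]
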